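/- arXiv:2104.10286 — 3 statements merged into one kernel-verified Lean document; each statement's English description precedes it below -/
import Mathlib

section
/- Let Σ be an alphabet and a ∈ ℕ⁺. Suppose R = fold(R',i,j) for some relation R' ⊆ (Σ⁺)^{a'} of non-empty strings and some i ≤ j, where fold(R',i,j) replaces the coordinates i through j of each tuple of R' by their tensor product. If R is regular, then R' (that is, unfold(R,i)) is regular. -/
open FirstOrder

/-- A language (set of strings) is regular if it is recognized by a
deterministic finite automaton with finitely many states. -/
def LangRegular {β : Type} (L : Set (List β)) : Prop :=
  Language.IsRegular (L : Language β)

/-- A `(Σ,w)`-layer: left/right frontiers contained in `{0,…,w−1}`, a set of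
transitions labelled by symbols of `Σ` or the padding symbol (`none`), sets of
initial and final states, and two boolean flags. -/
structure Layer (σ : Type) (w : ℕ) where
  left : Set (Fin w)
  right : Set (Fin w)
  trans : Set (Fin w × Option σ × Fin w)
  initial : Set (Fin w)
  final : Set (Fin w)
  ini : Bool
  fin : Bool
  trans_mem : ∀ t ∈ trans, t.1 ∈ left ∧ t.2.2 ∈ right
  initial_sub : initial ⊆ left
  final_sub : final ⊆ right
  initial_empty : ini = false → initial = ∅
  final_empty : fin = false → final = ∅

instance {σ : Type} {w : ℕ} : Inhabited (Layer σ w) :=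
  ⟨{ left := ∅, right := ∅, trans := ∅, initial := ∅, final := ∅,
     ini := false, fin := false,
     trans_mem := by simp, initial_sub := by simp, final_sub := by simp,
     initial_empty := fun _ => rfl, final_empty := fun _ => rfl }⟩

/-- A string of layers is a `(Σ,w)`-ODD: it is non-empty, consecutive frontiers
match, the initial flag is set exactly on the first layer, and the final flag is
set exactly on the last layer. -/
def IsODD {σ : Type} {w : ℕ} (D : List (Layer σ w)) : Prop :=
  D ≠ [] ∧
  (∀ i : ℕ, (h : i + 1 < D.length) →
    (D[i + 1]'h).left = (D[i]'(by omega)).right) ∧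
  (∀ i : ℕ, (h : i < D.length) →
    ((D[i]'h).ini = true ↔ i = 0) ∧ ((D[i]'h).fin = true ↔ i = D.length - 1))

/-- Acceptance of a (non-empty) string `s` of length at most `|D|` by the ODD `D`:
there is a sequence of compatible transitions, reading the symbols of `s` followed
by padding symbols, from an initial state of the first layer to a final state of
the last layer. -/
def OddAccepts {σ : Type} {w : ℕ} (D : List (Layer σ w)) (s : List σ) : Prop :=
  s ≠ [] ∧ s.length ≤ D.length ∧
  ∃ st : ℕ → Fin w,
    (∀ i : ℕ, (h : i < D.length) → (st i, s[i]?, st (i + 1)) ∈ (D[i]'h).trans) ∧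
    ∀ h : 0 < D.length,
      st 0 ∈ (D[0]'h).initial ∧ st D.length ∈ (D[D.length - 1]'(by omega)).final

/-- The language of an ODD. -/
def OddLang {σ : Type} {w : ℕ} (D : List (Layer σ w)) : Set (List σ) :=
  { s | OddAccepts D s }

/-- Convolution (tensor product) of a family of strings over (possibly different)
alphabets: the string of length `max_i |u_i|` whose `j`-th symbol has `i`-th
component the `j`-th symbol of `u_i` if `j < |u_i|`, and the padding symbol `none`
otherwise. -/
def convD {a : ℕ} {α : Fin a → Type} (us : ∀ i, List (α i)) :
    List (∀ i, Option (α i)) :=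
  List.ofFn fun j : Fin (Finset.univ.sup fun i => (us i).length) =>
    fun i => (us i)[(j : ℕ)]?

/-- A relation of tuples of strings is regular if its associated language, the set
of convolutions of its tuples, is a regular language. -/
def RegularRelD {a : ℕ} {α : Fin a → Type} (R : Set (∀ i, List (α i))) : Prop :=
  LangRegular { x | ∃ us ∈ R, convD us = x }

/-- Convolution of a pair of strings over two alphabets. -/
def conv2 {α β : Type} (u : List α) (v : List β) : List (Option α × Option β) :=
  List.ofFn fun j : Fin (max u.length v.length) => (u[(j : ℕ)]?, v[(j : ℕ)]?)

/-- A binary relation of strings is regular if its associated language is regular. -/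
def Regular2 {α β : Type} (R : Set (List α × List β)) : Prop :=
  LangRegular { x | ∃ p ∈ R, conv2 p.1 p.2 = x }

/-- Convolution of an `(a+1)`-tuple of strings `(u, v₁, …, vₐ)` where `u` is over
the alphabet `α` and the `v`s over the alphabet `β`. -/
def conv1a {α β : Type} {a : ℕ} (u : List α) (vs : Fin a → List β) :
    List (Option α × (Fin a → Option β)) :=
  List.ofFn fun j : Fin (max u.length (Finset.univ.sup fun i => (vs i).length)) =>
    (u[(j : ℕ)]?, fun i => (vs i)[(j : ℕ)]?)

/-- An `(a+1)`-ary relation whose first coordinate is a string over `α` and whose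
remaining `a` coordinates are strings over `β` is regular if its associated
language of convolutions is regular. -/
def Regular1a {α β : Type} {a : ℕ} (R : Set (List α × (Fin a → List β))) : Prop :=
  LangRegular { x | ∃ p ∈ R, conv1a p.1 p.2 = x }

/-- The `a`-fold tensor product `L^{⊗a}` of a language `L`. -/
def tensorLang {σ : Type} {a : ℕ} (L : Set (List σ)) :
    Set (List (Fin a → Option σ)) :=
  { x | ∃ us : Fin a → List σ, (∀ i, us i ∈ L) ∧ convD us = x }

/-- The purely relational first-order vocabulary with `r` relation symbols of
arities `ar 0, …, ar (r-1)`. -/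
def vocLang (r : ℕ) (ar : Fin r → ℕ) : FirstOrder.Language :=
  { Functions := fun _ => Empty, Relations := fun n => { i : Fin r // ar i = n } }

/-- A tuple `(D₀, D₁, …, Dᵣ)` is `(Σ,w,τ)`-structural: all ODDs have a common
length, `D₀` is over `Σ`, `Dᵢ` is over `Σ^{⊗aᵢ}` (with padding components), and
`L(Dᵢ) ⊆ L(D₀)^{⊗aᵢ}`. -/
def IsStructural {σ : Type} {w r : ℕ} {ar : Fin r → ℕ}
    (D₀ : List (Layer σ w))
    (Ds : ∀ i : Fin r, List (Layer (Fin (ar i) → Option σ) w)) : Prop :=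
  IsODD D₀ ∧
  ∀ i : Fin r, IsODD (Ds i) ∧ (Ds i).length = D₀.length ∧
    OddLang (Ds i) ⊆ tensorLang (OddLang D₀)

/-- The `τ`-structure derived from a structural tuple: its domain is `L(D₀)` and
the `i`-th relation holds of `(u₁,…,u_{aᵢ})` iff `u₁⊗⋯⊗u_{aᵢ} ∈ L(Dᵢ)`. -/
def derivedStr {σ : Type} {w r : ℕ} {ar : Fin r → ℕ}
    (D₀ : List (Layer σ w))
    (Ds : ∀ i : Fin r, List (Layer (Fin (ar i) → Option σ) w)) :
    (vocLang r ar).Structure { s : List σ // s ∈ OddLang D₀ } where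
  funMap := fun f _ => f.elim
  RelMap := fun {n} Rl x =>
    match Rl with
    | ⟨i, h⟩ =>
      convD (fun m : Fin (ar i) => (x (Fin.cast h m)).val) ∈ OddLang (Ds i)

/-- The type of `(r+1)`-tuples of ODDs `(D₀, D₁, …, Dᵣ)`. -/
def StructTuple (σ : Type) (w r : ℕ) (ar : Fin r → ℕ) : Type :=
  List (Layer σ w) × ((i : Fin r) → List (Layer (Fin (ar i) → Option σ) w))

/-- Convolution of an `(r+1)`-tuple of ODDs. -/
def convTuple {σ : Type} {w r : ℕ} {ar : Fin r → ℕ} (q : StructTuple σ w r ar) :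
    List (Option (Layer σ w) ×
      ((i : Fin r) → Option (Layer (Fin (ar i) → Option σ) w))) :=
  List.ofFn fun j : Fin (max q.1.length (Finset.univ.sup fun i => (q.2 i).length)) =>
    (q.1[(j : ℕ)]?, fun i => (q.2 i)[(j : ℕ)]?)

/-- A set of `(r+1)`-tuples of ODDs is regular if its associated language of
convolutions is regular. -/
def RegularTuple {σ : Type} {w r : ℕ} {ar : Fin r → ℕ}
    (R : Set (StructTuple σ w r ar)) : Prop :=
  LangRegular { x | ∃ q ∈ R, convTuple q = x }

/-- The type of `(r+1+p)`-tuples `(D₀, D₁, …, Dᵣ, v₁, …, v_p)`. -/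
def StructTupleV (σ : Type) (w r : ℕ) (ar : Fin r → ℕ) (p : ℕ) : Type :=
  StructTuple σ w r ar × (Fin p → List σ)

/-- Convolution of an `(r+1+p)`-tuple `(D₀, D₁, …, Dᵣ, v₁, …, v_p)`. -/
def convStruct {σ : Type} {w r : ℕ} {ar : Fin r → ℕ} {p : ℕ}
    (q : StructTupleV σ w r ar p) :
    List ((Option (Layer σ w) ×
        ((i : Fin r) → Option (Layer (Fin (ar i) → Option σ) w))) ×
      (Fin p → Option σ)) :=
  List.ofFn fun j : Fin (max (max q.1.1.length
      (Finset.univ.sup fun i => (q.1.2 i).length))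
      (Finset.univ.sup fun t => (q.2 t).length)) =>
    ((q.1.1[(j : ℕ)]?, fun i => (q.1.2 i)[(j : ℕ)]?), fun t => (q.2 t)[(j : ℕ)]?)

/-- A set of `(r+1+p)`-tuples is regular if its associated language of
convolutions is regular. -/
def RegularStruct {σ : Type} {w r : ℕ} {ar : Fin r → ℕ} {p : ℕ}
    (R : Set (StructTupleV σ w r ar p)) : Prop :=
  LangRegular { x | ∃ q ∈ R, convStruct q = x }

/-- The family of alphabets of the coordinates of `fold(R,i,j)`: coordinate `i`
ranges over strings over the tensor power alphabet, all other coordinates over `σ`. -/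
def foldType (σ : Type) (a i j : ℕ) : Fin (a - (j - i)) → Type :=
  fun t => if (t : ℕ) = i then (Fin (j + 1 - i) → Option σ) else σ

/-- `fold(R,i,j)`: the coordinates `i` through `j` of each tuple of `R` are
replaced by their tensor product (coordinates are indexed from `0` here). -/
def foldRel {σ : Type} {a : ℕ} (i j : ℕ) (hij : i ≤ j) (hj : j < a)
    (R : Set (Fin a → List σ)) :
    Set ((t : Fin (a - (j - i))) → List (foldType σ a i j t)) :=
  { vs | ∃ us ∈ R,
      (∀ t : Fin (a - (j - i)), (t : ℕ) < i →
        HEq (vs t) (us ⟨(t : ℕ), by omega⟩)) ∧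
      (∀ t : Fin (a - (j - i)), (t : ℕ) = i →
        HEq (vs t) (convD (α := fun _ : Fin (j + 1 - i) => σ)
          (fun m => us ⟨i + (m : ℕ), by have := m.isLt; omega⟩))) ∧
      (∀ t : Fin (a - (j - i)), i < (t : ℕ) →
        HEq (vs t) (us ⟨(t : ℕ) + (j - i), by have := t.isLt; omega⟩)) }

/-- Regular languages are closed under preimages of letter-to-letter maps. -/
theorem LangRegular.preimage_map {α β : Type} {L : Set (List β)} (hL : LangRegular L)
    (f : α → β) : LangRegular {x : List α | x.map f ∈ L} := by
  obtain ⟨S, hS, M, hM⟩ := hL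
  refine ⟨S, hS, M.comap f, ?_⟩
  rw [DFA.accepts_comap, hM]
  rfl

theorem lt_sup_length_iff {a : ℕ} {α : Fin a → Type} (us : ∀ i, List (α i)) (l : ℕ) :
    l < (Finset.univ.sup fun i => (us i).length) ↔ ∃ i, l < (us i).length := by
  simp [Finset.lt_sup_iff]

theorem length_convD {a : ℕ} {α : Fin a → Type} (us : ∀ i, List (α i)) :
    (convD us).length = Finset.univ.sup fun i => (us i).length := by
  simp [convD]

open Classical in
theorem getElem?_convD {a : ℕ} {α : Fin a → Type} (us : ∀ i, List (α i)) (l : ℕ) :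
    (convD us)[l]? =
      if ∀ i, (us i)[l]? = none then none else some fun i => (us i)[l]? := by
  have h := lt_sup_length_iff us l
  simp only [convD, List.getElem?_ofFn]
  split_ifs with h1 h2 h2
  · obtain ⟨i, hi⟩ := h.1 h1
    exact absurd (List.getElem?_eq_none_iff.1 (h2 i)) (by omega)
  · rfl
  · rfl
  · exact absurd (fun i => List.getElem?_eq_none (not_lt.1 fun hi => h1 (h.2 ⟨i, hi⟩))) h2

theorem foldType_of_eq (σ : Type) {a i j : ℕ} {t : Fin (a - (j - i))} (h : (t : ℕ) = i) :
    foldType σ a i j t = (Fin (j + 1 - i) → Option σ) :=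
  if_pos h

theorem foldType_of_ne (σ : Type) {a i j : ℕ} {t : Fin (a - (j - i))} (h : (t : ℕ) ≠ i) :
    foldType σ a i j t = σ :=
  if_neg h

theorem HEq.list_getElem? {α β : Type} (h : α = β) {u : List α} {v : List β}
    (huv : HEq u v) (l : ℕ) : HEq u[l]? v[l]? := by
  subst h
  cases huv
  rfl

theorem HEq.list_length {α β : Type} (h : α = β) {u : List α} {v : List β}
    (huv : HEq u v) : u.length = v.length := by
  subst h
  cases huv
  rfl

section Fold

variable {σ : Type} {a : ℕ} (i j : ℕ) (hij : i ≤ j) (hj : j < a)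

/-- `vs` is the tuple obtained from `us` by folding the coordinates `i` through `j`. -/
def IsFold (us : Fin a → List σ) (vs : (t : Fin (a - (j - i))) → List (foldType σ a i j t)) :
    Prop :=
  (∀ t : Fin (a - (j - i)), (t : ℕ) < i → HEq (vs t) (us ⟨(t : ℕ), by omega⟩)) ∧
  (∀ t : Fin (a - (j - i)), (t : ℕ) = i →
    HEq (vs t) (convD (α := fun _ : Fin (j + 1 - i) => σ)
      (fun m => us ⟨i + (m : ℕ), by have := m.isLt; omega⟩))) ∧
  (∀ t : Fin (a - (j - i)), i < (t : ℕ) →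
    HEq (vs t) (us ⟨(t : ℕ) + (j - i), by have := t.isLt; omega⟩))

/-- The tuple obtained from `us` by folding the coordinates `i` through `j`. -/
def foldTuple (us : Fin a → List σ) (t : Fin (a - (j - i))) : List (foldType σ a i j t) :=
  if h : (t : ℕ) = i then
    cast (congrArg List (foldType_of_eq σ h).symm)
      (convD (α := fun _ : Fin (j + 1 - i) => σ)
        (fun m => us ⟨i + (m : ℕ), by have := m.isLt; omega⟩))
  else if (t : ℕ) < i then
    cast (congrArg List (foldType_of_ne σ h).symm) (us ⟨(t : ℕ), by omega⟩)
  else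
    cast (congrArg List (foldType_of_ne σ h).symm)
      (us ⟨(t : ℕ) + (j - i), by have := t.isLt; omega⟩)

theorem isFold_foldTuple (us : Fin a → List σ) :
    IsFold i j hij hj us (foldTuple i j hij hj us) := by
  refine ⟨fun t ht => ?_, fun t ht => ?_, fun t ht => ?_⟩
  · rw [foldTuple, dif_neg ht.ne, if_pos ht]
    exact cast_heq _ _
  · rw [foldTuple, dif_pos ht]
    exact cast_heq _ _
  · rw [foldTuple, dif_neg ht.ne', if_neg ht.not_gt]
    exact cast_heq _ _

theorem foldTuple_mem_foldRel {R : Set (Fin a → List σ)} {us : Fin a → List σ} (hus : us ∈ R) :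
    foldTuple i j hij hj us ∈ foldRel i j hij hj R :=
  ⟨us, hus, isFold_foldTuple i j hij hj us⟩

open Classical in
/-- The action of folding on a single column of a convolution: the entries `i` through `j`
are grouped into one symbol, which is the padding symbol if they all are. -/
noncomputable def foldLetter (b : Fin a → Option σ) (t : Fin (a - (j - i))) :
    Option (foldType σ a i j t) :=
  if h : (t : ℕ) = i then
    cast (congrArg Option (foldType_of_eq σ h).symm)
      (if ∀ m : Fin (j + 1 - i), b ⟨i + (m : ℕ), by have := m.isLt; omega⟩ = none then none
        else some fun m => b ⟨i + (m : ℕ), by have := m.isLt; omega⟩)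
  else if (t : ℕ) < i then
    cast (congrArg Option (foldType_of_ne σ h).symm) (b ⟨(t : ℕ), by omega⟩)
  else
    cast (congrArg Option (foldType_of_ne σ h).symm)
      (b ⟨(t : ℕ) + (j - i), by have := t.isLt; omega⟩)

theorem foldLetter_injective :
    Function.Injective (foldLetter (σ := σ) i j hij hj) := by
  intro b c hbc
  ext1 k
  rcases lt_or_ge (k : ℕ) i with hk | hk
  · have h := congrFun hbc ⟨k, by omega⟩
    simpa [foldLetter, hk, hk.ne] using h
  rcases le_or_gt (k : ℕ) j with hk' | hk'
  · have h := congrFun hbc ⟨i, by omega⟩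
    simp only [foldLetter, dif_pos, cast_inj] at h
    have hm : ∀ d : Fin a → Option σ, d k = d ⟨i + (k - i), by omega⟩ := fun d =>
      congrArg d (Fin.ext (by simp only; omega))
    rw [hm b, hm c]
    split_ifs at h with h1 h2 h2
    · exact (h1 ⟨k - i, by omega⟩).trans (h2 ⟨k - i, by omega⟩).symm
    · exact congrFun (Option.some.inj h) ⟨k - i, by omega⟩
  · have h := congrFun hbc ⟨k - (j - i), by omega⟩
    have h1 : ¬ ((k : ℕ) - (j - i) = i) := by omega
    have h2 : ¬ ((k : ℕ) - (j - i) < i) := by omega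
    have h3 : (k : ℕ) - (j - i) + (j - i) = k := by omega
    simpa [foldLetter, h1, h2, h3] using h

theorem foldLetter_getElem? (us : Fin a → List σ)
    (vs : (t : Fin (a - (j - i))) → List (foldType σ a i j t)) (h : IsFold i j hij hj us vs)
    (l : ℕ) : foldLetter i j hij hj (fun k => (us k)[l]?) = fun t => (vs t)[l]? := by
  obtain ⟨h1, h2, h3⟩ := h
  ext1 t
  apply eq_of_heq
  rcases lt_trichotomy (t : ℕ) i with ht | ht | ht
  · rw [foldLetter, dif_neg ht.ne, if_pos ht]
    exact (cast_heq _ _).trans (HEq.list_getElem? (foldType_of_ne σ ht.ne) (h1 t ht) l).symm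
  · rw [foldLetter, dif_pos ht]
    refine (cast_heq _ _).trans (HEq.trans (heq_of_eq ?_)
      (HEq.list_getElem? (foldType_of_eq σ ht) (h2 t ht) l).symm)
    rw [getElem?_convD]
  · rw [foldLetter, dif_neg ht.ne', if_neg ht.not_gt]
    exact (cast_heq _ _).trans (HEq.list_getElem? (foldType_of_ne σ ht.ne') (h3 t ht) l).symm

theorem sup_length_of_isFold (us : Fin a → List σ)
    (vs : (t : Fin (a - (j - i))) → List (foldType σ a i j t)) (h : IsFold i j hij hj us vs) :
    (Finset.univ.sup fun t => (vs t).length) = Finset.univ.sup fun k => (us k).length := by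
  obtain ⟨h1, h2, h3⟩ := h
  have hle (k : Fin a) : (us k).length ≤ Finset.univ.sup fun k => (us k).length :=
    Finset.le_sup (f := fun k => (us k).length) (Finset.mem_univ k)
  have hle' (t : Fin (a - (j - i))) : (vs t).length ≤ Finset.univ.sup fun t => (vs t).length :=
    Finset.le_sup (f := fun t => (vs t).length) (Finset.mem_univ t)
  apply le_antisymm
  · refine Finset.sup_le fun t _ => ?_
    rcases lt_trichotomy (t : ℕ) i with ht | ht | ht
    · rw [HEq.list_length (foldType_of_ne σ ht.ne) (h1 t ht)]
      exact hle _
    · rw [HEq.list_length (foldType_of_eq σ ht) (h2 t ht), length_convD]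
      exact Finset.sup_le fun m _ => hle _
    · rw [HEq.list_length (foldType_of_ne σ ht.ne') (h3 t ht)]
      exact hle _
  · refine Finset.sup_le fun k _ => ?_
    rcases lt_or_ge (k : ℕ) i with hk | hk
    · have ht := HEq.list_length (foldType_of_ne σ hk.ne) (h1 ⟨k, by omega⟩ hk)
      exact ht ▸ hle' _
    rcases le_or_gt (k : ℕ) j with hk' | hk'
    · refine le_trans ?_ (hle' ⟨i, by omega⟩)
      rw [HEq.list_length (foldType_of_eq σ rfl) (h2 ⟨i, by omega⟩ rfl), length_convD]
      have hm : k = ⟨i + (k - i), by omega⟩ := Fin.ext (by simp only; omega)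
      rw [hm]
      exact Finset.le_sup (f := fun m : Fin (j + 1 - i) => (us ⟨i + (m : ℕ), by omega⟩).length)
        (Finset.mem_univ ⟨k - i, by omega⟩)
    · have hlt : i < (k : ℕ) - (j - i) := by omega
      refine le_trans (le_of_eq ?_) (hle' ⟨k - (j - i), by omega⟩)
      rw [HEq.list_length (foldType_of_ne σ hlt.ne') (h3 ⟨k - (j - i), by omega⟩ hlt)]
      have hm : k = ⟨k - (j - i) + (j - i), by omega⟩ := Fin.ext (by simp only; omega)
      exact congrArg (fun k => (us k).length) hm

theorem map_foldLetter_convD (us : Fin a → List σ)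
    (vs : (t : Fin (a - (j - i))) → List (foldType σ a i j t)) (h : IsFold i j hij hj us vs) :
    (convD (α := fun _ : Fin a => σ) us).map (foldLetter i j hij hj) = convD vs := by
  refine List.ext_getElem ?_ fun l _ _ => ?_
  · simp only [List.length_map, length_convD, sup_length_of_isFold i j hij hj us vs h]
  · simpa [convD] using foldLetter_getElem? i j hij hj us vs h l

end Fold

/-- Regular relations are closed under the `unfold` operation: if `fold(R',i,j)`
is regular, then `R'` is regular. -/
theorem stmt7 (σ : Type) [Fintype σ] [Nonempty σ] (a : ℕ) (ha : 0 < a)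
    (i j : ℕ) (hij : i ≤ j) (hj : j < a)
    (R' : Set (Fin a → List σ)) (hne : ∀ us ∈ R', ∀ t, us t ≠ [])
    (hreg : RegularRelD (α := foldType σ a i j) (foldRel i j hij hj R')) :
    RegularRelD (α := fun _ : Fin a => σ) R' := by
  have key : {x | ∃ us ∈ R', convD (α := fun _ : Fin a => σ) us = x} =
      {x | x.map (foldLetter i j hij hj) ∈
        {x | ∃ vs ∈ foldRel i j hij hj R', convD (α := foldType σ a i j) vs = x}} := by
    ext x
    constructor
    · rintro ⟨us, hus, rfl⟩
      exact ⟨foldTuple i j hij hj us, foldTuple_mem_foldRel i j hij hj hus,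
        (map_foldLetter_convD i j hij hj us _ (isFold_foldTuple i j hij hj us)).symm⟩
    · rintro ⟨vs, ⟨us, hus, hvs⟩, hx⟩
      rw [← map_foldLetter_convD i j hij hj us vs hvs] at hx
      exact ⟨us, hus, (foldLetter_injective i j hij hj).list_map hx⟩
  unfold RegularRelD
  rw [key]
  exact hreg.preimage_map _
end

section
/- For every alphabet Σ and all w, a ∈ ℕ⁺, the binary relation R_⊆(Σ,w,a) = {(D, D') : D ∈ B⊕(Σ,w), D' ∈ B⊕(Σ^{⊗a},w), and L(D') ⊆ L(D)^{⊗a}} is regular, where L(D)^{⊗a} denotes the a-fold tensor product of the language L(D) with itself. -/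
open FirstOrder

/-! ### Closure properties of regular languages -/

theorem LangRegular.inter {α : Type} {L₁ L₂ : Set (List α)} (h₁ : LangRegular L₁)
    (h₂ : LangRegular L₂) : LangRegular (L₁ ∩ L₂) :=
  Language.IsRegular.inf h₁ h₂

theorem LangRegular.compl {α : Type} {L : Set (List α)} (h : LangRegular L) :
    LangRegular Lᶜ :=
  Language.IsRegular.compl h

theorem LangRegular.comap {α β : Type} {L : Set (List β)} (h : LangRegular L) (f : α → β) :
    LangRegular {x : List α | x.map f ∈ L} := by
  obtain ⟨Q, hQ, M, hM⟩ := h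
  exact ⟨Q, hQ, M.comap f, by rw [DFA.accepts_comap, hM]; rfl⟩

theorem langRegular_univ {α : Type} : LangRegular (Set.univ : Set (List α)) := by
  refine ⟨Unit, inferInstance, ⟨fun _ _ => (), (), Set.univ⟩, ?_⟩
  ext x
  simp only [DFA.mem_accepts, Set.mem_univ, true_iff]
  exact Set.mem_univ x

theorem LangRegular.setOf_forall {α ι : Type} [Finite ι] {L : ι → Set (List α)}
    (h : ∀ i, LangRegular (L i)) : LangRegular {x | ∀ i, x ∈ L i} := by
  classical
  have := Fintype.ofFinite ι
  have key : ∀ s : Finset ι, LangRegular {x | ∀ i ∈ s, x ∈ L i} := by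
    intro s
    induction s using Finset.induction_on with
    | empty =>
      have he : {x | ∀ i ∈ (∅ : Finset ι), x ∈ L i} = Set.univ := by ext; simp
      rw [he]
      exact langRegular_univ
    | insert j s _ ih =>
      have he : {x | ∀ i ∈ insert j s, x ∈ L i} = L j ∩ {x | ∀ i ∈ s, x ∈ L i} := by
        ext; simp
      rw [he]
      exact (h j).inter ih
  simpa using key Finset.univ

theorem langRegular_accepts {α Q : Type} [Finite Q] (M : NFA α Q) :
    LangRegular {x | x ∈ M.accepts} := by
  classical
  have := Fintype.ofFinite Q
  exact ⟨Set Q, inferInstance, M.toDFA, M.toDFA_correct⟩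

theorem LangRegular.image_fst {α β : Type} {L : Set (List (α × β))} (h : LangRegular L) :
    LangRegular {x : List α | ∃ z ∈ L, z.map Prod.fst = x} := by
  obtain ⟨Q, hQ, M, hM⟩ := h
  let N : NFA α Q := ⟨fun q a => {q' | ∃ b, M.step q (a, b) = q'}, {M.start}, M.accept⟩
  have key : ∀ x q, q ∈ N.eval x ↔ ∃ z, z.map Prod.fst = x ∧ M.eval z = q := by
    intro x
    induction x using List.reverseRecOn with
    | nil =>
      intro q
      simp only [NFA.eval_nil, List.map_eq_nil_iff, exists_eq_left, DFA.eval_nil]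
      exact eq_comm
    | append_singleton x a ih =>
      intro q
      simp only [NFA.eval_append_singleton, NFA.mem_stepSet, ih]
      constructor
      · rintro ⟨_, ⟨z, rfl, rfl⟩, b, rfl⟩
        exact ⟨z ++ [(a, b)], by simp, by simp⟩
      · rintro ⟨z, hz, rfl⟩
        obtain ⟨z₁, z₂, rfl, rfl, h₂⟩ := List.map_eq_append_iff.1 hz
        obtain ⟨⟨a', b⟩, rfl, rfl⟩ := List.map_eq_singleton_iff.1 h₂
        exact ⟨_, ⟨z₁, rfl, rfl⟩, b, by simp⟩
  convert langRegular_accepts N using 1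
  ext x
  simp only [Set.mem_ofPred_eq, NFA.mem_accepts]
  change _ ↔ ∃ q ∈ M.accept, q ∈ N.eval x
  simp only [key]
  rw [← hM]
  constructor
  · rintro ⟨z, hz, hx⟩
    exact ⟨_, hz, z, hx, rfl⟩
  · rintro ⟨_, hq, z, hx, rfl⟩
    exact ⟨z, hq, hx⟩

/-- Languages of strings admitting a labelling of the gaps between letters by states that
satisfies a local condition at each letter. -/
theorem langRegular_run {α Q : Type} [Finite Q] (S F : Set Q) (P : Q → α → Q → Prop) :
    LangRegular {y : List α | ∃ st : ℕ → Q, st 0 ∈ S ∧ st y.length ∈ F ∧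
      ∀ i (h : i < y.length), P (st i) y[i] (st (i + 1))} := by
  let N : NFA α Q := ⟨fun q a => {q' | P q a q'}, S, F⟩
  have key : ∀ x q, q ∈ N.eval x ↔ ∃ st : ℕ → Q, st 0 ∈ S ∧ st x.length = q ∧
      ∀ i (h : i < x.length), P (st i) x[i] (st (i + 1)) := by
    intro x
    induction x using List.reverseRecOn with
    | nil =>
      intro q
      simp only [NFA.eval_nil, List.length_nil, Nat.not_lt_zero]
      constructor
      · intro h
        exact ⟨fun _ => q, h, rfl, by simp⟩
      · rintro ⟨st, h, rfl, -⟩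
        exact h
    | append_singleton x a ih =>
      intro q
      simp only [NFA.eval_append_singleton, NFA.mem_stepSet, ih]
      constructor
      · rintro ⟨_, ⟨st, h0, rfl, hst⟩, hq⟩
        refine ⟨fun i => if i ≤ x.length then st i else q, by simpa using h0, by simp, ?_⟩
        intro i hi
        simp only [List.length_append, List.length_singleton] at hi
        rcases Nat.lt_or_ge i x.length with hlt | hge
        · have := hst i hlt
          simpa [hlt, hlt.le, List.getElem_append_left hlt] using this
        · obtain rfl : i = x.length := by omega
          simpa using show P (st x.length) a q from hq
      · rintro ⟨st, h0, rfl, hst⟩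
        refine ⟨st x.length, ⟨st, h0, rfl, ?_⟩, ?_⟩
        · intro i hi
          have := hst i (by simp; omega)
          rwa [List.getElem_append_left hi] at this
        · have := hst x.length (by simp)
          rw [List.getElem_concat_length rfl] at this
          rw [List.length_append, List.length_singleton]
          exact this
  convert langRegular_accepts N using 1
  ext x
  simp only [Set.mem_ofPred_eq, NFA.mem_accepts]
  change _ ↔ ∃ q ∈ F, q ∈ N.eval x
  simp only [key]
  constructor
  · rintro ⟨st, h0, hF, h⟩
    exact ⟨_, hF, st, h0, rfl, h⟩
  · rintro ⟨_, hF, st, h0, rfl, h⟩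
    exact ⟨st, h0, hF, h⟩

/-- The letter before position `i`, and `none` at the beginning of the string. -/
def prevLetter {α : Type} (y : List α) : ℕ → Option α
  | 0 => none
  | i + 1 => y[i]?

/-- Strictly local languages: `P` constrains each pair of consecutive letters, where both ends of
the string are marked by `none`. -/
theorem langRegular_local {α : Type} [Finite α] (P : Option α → Option α → Prop) :
    LangRegular {y : List α | ∀ i ≤ y.length, P (prevLetter y i) y[i]?} := by
  convert langRegular_run {none} {q | P q none}
    (fun (q : Option α) (a : α) q' => P q (some a) ∧ q' = some a) using 1
  ext y
  simp only [Set.mem_ofPred_eq, Set.mem_singleton_iff]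
  constructor
  · intro h
    refine ⟨prevLetter y, rfl, by simpa using h y.length le_rfl, fun i hi => ⟨?_, ?_⟩⟩
    · simpa [hi] using h i hi.le
    · simp [prevLetter, hi]
  · rintro ⟨st, h0, hF, h⟩ i hi
    have hst : st i = prevLetter y i := by
      cases i with
      | zero => exact h0
      | succ i =>
        rw [(h i hi).2]
        simp [prevLetter, Nat.lt_of_succ_le hi]
    rw [← hst]
    rcases hi.lt_or_eq with hlt | rfl
    · rw [List.getElem?_eq_getElem hlt]
      exact (h i hlt).1
    · simpa using hF

theorem langRegular_forall_mem {α : Type} (p : α → Prop) :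
    LangRegular {y : List α | ∀ a ∈ y, p a} := by
  convert langRegular_run (Set.univ : Set Unit) Set.univ (fun _ (a : α) _ => p a) using 1
  ext y
  simp [List.forall_mem_iff_getElem]

/-! ### Padded strings -/

/-- `y` is the string `s` followed by padding symbols. -/
def IsPadding {τ : Type} (y : List (Option τ)) (s : List τ) : Prop :=
  s.length ≤ y.length ∧ ∀ i (h : i < y.length), y[i] = s[i]?

theorem IsPadding.getElem?_eq {τ : Type} {y : List (Option τ)} {s : List τ} (h : IsPadding y s)
    (i : ℕ) : s[i]? = y[i]?.join := by
  rcases Nat.lt_or_ge i y.length with hlt | hge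
  · simp [hlt, h.2 i hlt]
  · simp [hge, h.1.trans hge]

theorem IsPadding.unique {τ : Type} {y : List (Option τ)} {s t : List τ} (hs : IsPadding y s)
    (ht : IsPadding y t) : s = t :=
  List.ext_getElem? fun i => by rw [hs.getElem?_eq, ht.getElem?_eq]

theorem exists_isPadding_iff {τ : Type} {y : List (Option τ)} :
    (∃ s, IsPadding y s) ↔
      ∀ i ≤ y.length, ¬ (prevLetter y i = some none ∧ ∃ a, y[i]? = some (some a)) := by
  constructor
  · rintro ⟨s, hs⟩ i - ⟨h₁, a, h₂⟩
    cases i with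
    | zero => simp [prevLetter] at h₁
    | succ i =>
      have e₁ := hs.getElem?_eq i
      have e₂ := hs.getElem?_eq (i + 1)
      rw [prevLetter] at h₁
      simp only [h₁, Option.join_some, List.getElem?_eq_none_iff] at e₁
      simp only [h₂, Option.join_some] at e₂
      have := (List.getElem?_eq_some_iff.1 e₂).1
      omega
  · induction y with
    | nil => exact fun _ => ⟨[], by simp [IsPadding]⟩
    | cons o y ih =>
      intro h
      obtain ⟨s, hs⟩ := ih fun i hi hc => by
        refine h (i + 1) (by simpa using hi) ⟨?_, by simpa using hc.2⟩
        cases i with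
        | zero => simp [prevLetter] at hc
        | succ i => simpa [prevLetter] using hc.1
      cases o with
      | some a =>
        refine ⟨a :: s, by simpa using hs.1, fun i hi => ?_⟩
        cases i with
        | zero => simp
        | succ i => simpa using hs.2 i (by simpa using hi)
      | none =>
        refine ⟨[], by simp, fun i hi => ?_⟩
        have hn : s = [] := by
          by_contra hne
          have hpos : 0 < s.length := List.length_pos_iff.2 hne
          have hy : 0 < y.length := hpos.trans_le hs.1
          refine h 1 (by simp) ⟨by simp [prevLetter], s[0], ?_⟩
          simp [hy, hs.2 0 hy, hpos]
        subst hn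
        cases i with
        | zero => simp
        | succ i => simpa using hs.2 i (by simpa using hi)

theorem langRegular_isPadding {τ : Type} [Finite τ] :
    LangRegular {y : List (Option τ) | ∃ s, IsPadding y s} := by
  simp only [exists_isPadding_iff]
  exact langRegular_local fun p q => ¬ (p = some none ∧ ∃ a, q = some (some a))

theorem IsPadding.ne_nil_iff {τ : Type} {y : List (Option τ)} {s : List τ} (h : IsPadding y s) :
    s ≠ [] ↔ ∃ o ∈ y, o ≠ none := by
  constructor
  · intro hs
    have hpos := List.length_pos_iff.2 hs
    have hy := hpos.trans_le h.1
    exact ⟨y[0], List.getElem_mem hy, by simp [h.2 0 hy, hpos]⟩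
  · rintro ⟨o, ho, hne⟩ rfl
    obtain ⟨i, hi, rfl⟩ := List.getElem_of_mem ho
    exact hne (by simp [h.2 i hi])

theorem langRegular_isPadding_ne_nil {τ : Type} [Finite τ] :
    LangRegular {y : List (Option τ) | ∃ s, IsPadding y s ∧ s ≠ []} := by
  convert (langRegular_isPadding (τ := τ)).inter
    (langRegular_forall_mem (fun o : Option τ => o = none)).compl using 1
  ext y
  simp only [Set.mem_inter_iff, Set.mem_ofPred_eq, Set.mem_compl_iff, not_forall, exists_prop]
  constructor
  · rintro ⟨s, hs, hne⟩
    exact ⟨⟨s, hs⟩, hs.ne_nil_iff.1 hne⟩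
  · rintro ⟨⟨s, hs⟩, h⟩
    exact ⟨s, hs, hs.ne_nil_iff.2 h⟩

theorem conv2_eq_iff {α β : Type} {u : List α} {v : List β} {x : List (Option α × Option β)} :
    conv2 u v = x ↔ IsPadding (x.map Prod.fst) u ∧ IsPadding (x.map Prod.snd) v ∧
      ∀ o ∈ x, o ≠ (none, none) := by
  constructor
  · rintro rfl
    refine ⟨⟨by simp [conv2], fun i h => by simp [conv2]⟩,
      ⟨by simp [conv2], fun i h => by simp [conv2]⟩, fun o ho => ?_⟩
    simp only [conv2, List.mem_ofFn] at ho
    obtain ⟨⟨j, hj⟩, rfl⟩ := ho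
    simp only [ne_eq, Prod.mk.injEq, List.getElem?_eq_none_iff]
    omega
  · rintro ⟨hu, hv, hx⟩
    have h1 := hu.1
    have h2 := hv.1
    simp only [List.length_map] at h1 h2
    have hlen : max u.length v.length = x.length := by
      by_contra hne
      have hlt : max u.length v.length < x.length := by omega
      refine hx _ (List.getElem_mem hlt) (Prod.ext ?_ ?_)
      · have := hu.2 _ (by rwa [List.length_map])
        simpa using this
      · have := hv.2 _ (by rwa [List.length_map])
        simpa using this
    refine List.ext_getElem (by simp [conv2, hlen]) fun i h₁ h₂ => Prod.ext ?_ ?_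
    · have := hu.2 i (by simpa using h₂)
      simpa [conv2] using this.symm
    · have := hv.2 i (by simpa using h₂)
      simpa [conv2] using this.symm

/-- The string of `i`-th components of a padded string over a tensor power. -/
def componentPadding {σ : Type} {a : ℕ} (y : List (Option (Fin a → Option σ))) (i : Fin a) :
    List (Option σ) :=
  y.map fun o => o.bind fun f => f i

theorem convD_getElem {a : ℕ} {α : Fin a → Type} (us : ∀ i, List (α i)) (j : ℕ)
    (h : j < (convD us).length) (i : Fin a) : (convD us)[j] i = (us i)[j]? :=
  congrFun (List.getElem_ofFn h) i

theorem IsPadding.mem_tensorLang_iff {σ : Type} {a : ℕ} {y : List (Option (Fin a → Option σ))}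
    {s : List (Fin a → Option σ)} (h : IsPadding y s) (L : Set (List σ)) :
    s ∈ tensorLang L ↔ (∀ o ∈ y, o ≠ some fun _ => none) ∧
      ∀ i, ∃ u ∈ L, IsPadding (componentPadding y i) u := by
  have hsy := h.1
  constructor
  · rintro ⟨us, hus, rfl⟩
    refine ⟨fun o ho hc => ?_, fun i => ⟨us i, hus i, ?_, fun j hj => ?_⟩⟩
    · obtain ⟨j, hj, rfl⟩ := List.getElem_of_mem ho
      rw [h.2 j hj, List.getElem?_eq_some_iff] at hc
      obtain ⟨hlt, hc⟩ := hc
      have hlt' := hlt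
      simp only [convD, List.length_ofFn] at hlt'
      obtain ⟨i, -, hi⟩ := (Finset.lt_sup_iff).1 hlt'
      have hn := congrFun hc i
      rw [convD_getElem, List.getElem?_eq_none_iff] at hn
      omega
    · simp only [convD, List.length_ofFn] at hsy
      simp only [componentPadding, List.length_map]
      exact (Finset.le_sup (f := fun i => (us i).length) (Finset.mem_univ i)).trans hsy
    · simp only [componentPadding, List.length_map] at hj
      simp only [componentPadding, List.getElem_map, h.2 j hj]
      rcases Nat.lt_or_ge j (convD us).length with hlt | hge
      · rw [List.getElem?_eq_getElem hlt, Option.bind_some, convD_getElem]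
      · have hge' := hge
        simp only [convD, List.length_ofFn] at hge'
        have : (us i).length ≤ j :=
          (Finset.le_sup (f := fun i => (us i).length) (Finset.mem_univ i)).trans hge'
        simp [hge, this]
  · rintro ⟨hy, hc⟩
    choose us hus hpad using hc
    have hcomp : ∀ (i : Fin a) (j : ℕ), (us i)[j]? = s[j]?.bind (fun f : Fin a → Option σ => f i) := by
      intro i j
      rw [(hpad i).getElem?_eq, h.getElem?_eq, componentPadding, List.getElem?_map]
      cases y[j]? <;> simp
    have hlen : (Finset.univ.sup fun i => (us i).length) = s.length := by
      refine le_antisymm (Finset.sup_le fun i _ => ?_) ?_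
      · have := hcomp i s.length
        simpa using this
      · by_contra hlt
        push Not at hlt
        set j := Finset.univ.sup fun i => (us i).length with hj
        refine hy _ (List.getElem_mem (hlt.trans_le hsy)) ?_
        rw [h.2 j (hlt.trans_le hsy), List.getElem?_eq_getElem hlt]
        congr 1
        funext i
        have hi := hcomp i j
        have hle : (us i).length ≤ j :=
          Finset.le_sup (f := fun i => (us i).length) (Finset.mem_univ i)
        simpa [hlt, hle] using hi.symm
    refine ⟨us, hus, List.ext_getElem (by simp [convD, hlen]) fun j h₁ h₂ => ?_⟩
    funext i
    rw [convD_getElem]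
    simpa [h₂] using hcomp i j

/-! ### Automata reading padded ODDs -/

instance {σ : Type} [Finite σ] {w : ℕ} : Finite (Layer σ w) := by
  refine Finite.of_injective (fun L : Layer σ w =>
    (L.left, L.right, L.trans, L.initial, L.final, L.ini, L.fin)) ?_
  rintro ⟨⟩ ⟨⟩ h
  simpa using h

/-- The local condition characterizing padded ODDs. -/
def OddAdjacent {σ : Type} {w : ℕ} :
    Option (Option (Layer σ w)) → Option (Option (Layer σ w)) → Prop
  | none, some (some L) => L.ini = true
  | some (some L), some (some L') => L'.left = L.right ∧ L'.ini = false ∧ L.fin = false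
  | some (some L), _ => L.fin = true
  | some none, some (some _) => False
  | some none, _ => True
  | none, _ => False

theorem IsPadding.isODD_iff {σ : Type} {w : ℕ} {y : List (Option (Layer σ w))}
    {D : List (Layer σ w)} (h : IsPadding y D) :
    IsODD D ↔ ∀ i ≤ y.length, OddAdjacent (prevLetter y i) y[i]? := by
  have hle := h.1
  have hy : ∀ i, i < y.length → y[i]? = some D[i]? := fun i hi => by
    rw [List.getElem?_eq_getElem hi, h.2 i hi]
  constructor
  · rintro ⟨hne, hadj, hflag⟩ i hi
    have hpos := List.length_pos_iff.2 hne
    cases i with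
    | zero =>
      rw [hy 0 (by omega), List.getElem?_eq_getElem hpos]
      exact (hflag 0 hpos).1.2 rfl
    | succ j =>
      rw [prevLetter, hy j (by omega)]
      rcases Nat.lt_trichotomy (j + 1) D.length with hlt | heq | hgt
      · rw [hy (j + 1) (by omega), List.getElem?_eq_getElem hlt,
          List.getElem?_eq_getElem (by omega)]
        refine ⟨hadj j hlt, ?_, ?_⟩
        · have := (hflag (j + 1) hlt).1
          simpa using this
        · have := (hflag j (by omega)).2
          rw [← Bool.not_eq_true, this]
          omega
      · have hfin : (D[j]'(by omega)).fin = true := (hflag j (by omega)).2.2 (by omega)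
        rw [List.getElem?_eq_getElem (l := D) (by omega : j < D.length)]
        rcases hi.lt_or_eq with hlt' | heq'
        · rw [hy (j + 1) hlt', List.getElem?_eq_none heq.ge]
          exact hfin
        · rw [List.getElem?_eq_none heq'.ge]
          exact hfin
      · rw [List.getElem?_eq_none (l := D) (by omega : D.length ≤ j)]
        rcases hi.lt_or_eq with hlt' | heq'
        · rw [hy (j + 1) hlt', List.getElem?_eq_none hgt.le]
          trivial
        · rw [List.getElem?_eq_none heq'.ge]
          trivial
  · intro hloc
    have h0 := hloc 0 (Nat.zero_le _)
    have hpos : 0 < D.length := by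
      by_contra hn
      rcases Nat.eq_zero_or_pos y.length with hz | hz
      · rw [List.getElem?_eq_none hz.le] at h0
        exact h0
      · rw [hy 0 hz, List.getElem?_eq_none (by omega)] at h0
        exact h0
    rw [hy 0 (by omega), List.getElem?_eq_getElem hpos] at h0
    have hstep : ∀ j (hj : j + 1 < D.length),
        (D[j + 1]'hj).left = (D[j]'(by omega)).right ∧ (D[j + 1]'hj).ini = false ∧
          (D[j]'(by omega)).fin = false := fun j hj => by
      have := hloc (j + 1) (by omega)
      rw [prevLetter, hy j (by omega), hy (j + 1) (by omega), List.getElem?_eq_getElem hj,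
        List.getElem?_eq_getElem (by omega)] at this
      exact this
    have hlast : ∀ j (hj : j < D.length), j + 1 = D.length → (D[j]'hj).fin = true :=
      fun j hj hj' => by
      have := hloc (j + 1) (by omega)
      rw [prevLetter, hy j (by omega), List.getElem?_eq_getElem hj] at this
      rcases Nat.lt_or_ge (j + 1) y.length with hlt | hge
      · rw [hy (j + 1) hlt, List.getElem?_eq_none hj'.ge] at this
        exact this
      · rw [List.getElem?_eq_none hge] at this
        exact this
    refine ⟨List.length_pos_iff.1 hpos, fun i hi => (hstep i hi).1, fun i hi => ⟨?_, ?_⟩⟩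
    · cases i with
      | zero => exact ⟨fun _ => rfl, fun _ => h0⟩
      | succ i => simp [(hstep i hi).2.1]
    · rcases Nat.lt_or_ge (i + 1) D.length with hlt | hge
      · simp only [(hstep i hlt).2.2, Bool.false_eq_true, false_iff]
        omega
      · simp only [hlast i hi (by omega), true_iff]
        omega

theorem langRegular_isODD {σ : Type} [Finite σ] {w : ℕ} :
    LangRegular {y : List (Option (Layer σ w)) | ∃ D, IsPadding y D ∧ IsODD D} := by
  convert langRegular_isPadding.inter (langRegular_local (OddAdjacent (σ := σ) (w := w))) using 1
  ext y
  constructor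
  · rintro ⟨D, hD, h⟩
    exact ⟨⟨D, hD⟩, hD.isODD_iff.1 h⟩
  · rintro ⟨⟨D, hD⟩, h⟩
    exact ⟨D, hD, hD.isODD_iff.2 h⟩

/-- One step of a run of a padded ODD on a padded string. -/
def OddStep {σ : Type} {w : ℕ} (q : Fin w) :
    Option (Layer σ w) × Option σ → Fin w → Prop
  | (some L, o), q' => (q, o, q') ∈ L.trans ∧ (L.ini = true → q ∈ L.initial) ∧
      (L.fin = true → q' ∈ L.final)
  | (none, o), _ => o = none

theorem oddAccepts_iff_oddStep {σ : Type} {w : ℕ} {t : List (Option (Layer σ w) × Option σ)}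
    {D : List (Layer σ w)} {s : List σ} (hD : IsPadding (t.map Prod.fst) D) (hodd : IsODD D)
    (hs : IsPadding (t.map Prod.snd) s) (hne : s ≠ []) :
    OddAccepts D s ↔ ∃ st : ℕ → Fin w, ∀ i (h : i < t.length), OddStep (st i) t[i] (st (i + 1)) := by
  have ht : ∀ i (h : i < t.length), t[i] = (D[i]?, s[i]?) := fun i h => by
    refine Prod.ext ?_ ?_
    · rw [← hD.2 i (by simpa using h), List.getElem_map]
    · rw [← hs.2 i (by simpa using h), List.getElem_map]
  have hDt : D.length ≤ t.length := by simpa using hD.1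
  have hst : s.length ≤ t.length := by simpa using hs.1
  obtain ⟨hDne, -, hflag⟩ := hodd
  have hpos := List.length_pos_iff.2 hDne
  constructor
  · rintro ⟨-, hlen, st, htrans, hends⟩
    refine ⟨st, fun i hi => ?_⟩
    rw [ht i hi]
    rcases Nat.lt_or_ge i D.length with hlt | hge
    · rw [List.getElem?_eq_getElem hlt]
      refine ⟨htrans i hlt, fun h => ?_, fun h => ?_⟩
      · obtain rfl := (hflag i hlt).1.1 h
        exact (hends hpos).1
      · obtain rfl := (hflag i hlt).2.1 h
        have := (hends hpos).2
        rwa [Nat.sub_add_cancel hpos]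
    · rw [List.getElem?_eq_none hge, List.getElem?_eq_none (hlen.trans hge)]
      rfl
  · rintro ⟨st, hrun⟩
    have hD' : ∀ i (h : i < D.length), (st i, s[i]?, st (i + 1)) ∈ D[i].trans ∧
        (D[i].ini = true → st i ∈ D[i].initial) ∧
        (D[i].fin = true → st (i + 1) ∈ D[i].final) := fun i h => by
      have := hrun i (h.trans_le hDt)
      rwa [ht i (h.trans_le hDt), List.getElem?_eq_getElem h] at this
    refine ⟨hne, ?_, st, fun i h => (hD' i h).1, fun h => ⟨?_, ?_⟩⟩
    · by_contra hlt
      have hlt : D.length < t.length := by omega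
      have := hrun _ hlt
      rw [ht _ hlt, List.getElem?_eq_none le_rfl] at this
      have := List.getElem?_eq_none_iff.1 this
      omega
    · exact (hD' 0 h).2.1 ((hflag 0 h).1.2 rfl)
    · have := (hD' (D.length - 1) (by omega)).2.2 ((hflag _ (by omega)).2.2 rfl)
      rwa [Nat.sub_add_cancel h] at this

/-- The language of convolutions of an ODD and a string accepted by it, with extra padding. -/
def paddedAcceptance (σ : Type) (w : ℕ) : Set (List (Option (Layer σ w) × Option σ)) :=
  {t | ∃ D s, IsPadding (t.map Prod.fst) D ∧ IsODD D ∧ IsPadding (t.map Prod.snd) s ∧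
    s ∈ OddLang D}

theorem langRegular_paddedAcceptance {σ : Type} [Finite σ] {w : ℕ} :
    LangRegular (paddedAcceptance σ w) := by
  convert ((langRegular_isODD (σ := σ) (w := w)).comap Prod.fst).inter
    (((langRegular_isPadding_ne_nil (τ := σ)).comap Prod.snd).inter
      (langRegular_run (Set.univ : Set (Fin w)) Set.univ OddStep)) using 1
  ext t
  constructor
  · rintro ⟨D, s, hD, hodd, hs, hacc⟩
    obtain ⟨st, hst⟩ := (oddAccepts_iff_oddStep hD hodd hs hacc.1).1 hacc
    exact ⟨⟨D, hD, hodd⟩, ⟨s, hs, hacc.1⟩, st, trivial, trivial, hst⟩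
  · rintro ⟨⟨D, hD, hodd⟩, ⟨s, hs, hne⟩, st, -, -, hst⟩
    exact ⟨D, s, hD, hodd, hs, (oddAccepts_iff_oddStep hD hodd hs hne).2 ⟨st, hst⟩⟩

theorem mem_paddedAcceptance_iff {σ : Type} {w : ℕ} {t : List (Option (Layer σ w) × Option σ)}
    {D : List (Layer σ w)} (hD : IsPadding (t.map Prod.fst) D) (hodd : IsODD D) :
    t ∈ paddedAcceptance σ w ↔ ∃ s ∈ OddLang D, IsPadding (t.map Prod.snd) s := by
  constructor
  · rintro ⟨D', s, hD', -, hs, hacc⟩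
    obtain rfl := hD.unique hD'
    exact ⟨s, hacc, hs⟩
  · rintro ⟨s, hacc, hs⟩
    exact ⟨D, s, hD, hodd, hs, hacc⟩

/-- Triples of two padded ODDs and a padded string of the language of the second ODD that is not in
the `a`-fold tensor power of the language of the first one. -/
def nonInclusionWitnesses (σ : Type) (w a : ℕ) :
    Set (List ((Option (Layer σ w) × Option (Layer (Fin a → Option σ) w)) ×
      Option (Fin a → Option σ))) :=
  {z | z.map (fun c => (c.1.2, c.2)) ∈ paddedAcceptance (Fin a → Option σ) w} ∩
    ({z | z.map Prod.snd ∈ {y | ∀ o ∈ y, o ≠ some fun _ => none}} ∩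
      {z | ∀ i, z ∈ {z | z.map (fun c => (c.1.1, c.2.bind fun f => f i)) ∈
        paddedAcceptance σ w}})ᶜ

theorem langRegular_nonInclusionWitnesses {σ : Type} [Finite σ] {w a : ℕ} :
    LangRegular (nonInclusionWitnesses σ w a) :=
  (langRegular_paddedAcceptance.comap _).inter
    (((langRegular_forall_mem _).comap _).inter
      (LangRegular.setOf_forall fun _ => langRegular_paddedAcceptance.comap _)).compl

theorem mem_nonInclusionWitnesses_iff {σ : Type} {w a : ℕ}
    {z : List ((Option (Layer σ w) × Option (Layer (Fin a → Option σ) w)) ×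
      Option (Fin a → Option σ))} {D : List (Layer σ w)}
    {D' : List (Layer (Fin a → Option σ) w)}
    (hD : IsPadding ((z.map Prod.fst).map Prod.fst) D) (hodd : IsODD D)
    (hD' : IsPadding ((z.map Prod.fst).map Prod.snd) D') (hodd' : IsODD D') :
    z ∈ nonInclusionWitnesses σ w a ↔
      ∃ s ∈ OddLang D' \ tensorLang (OddLang D), IsPadding (z.map Prod.snd) s := by
  have key : ∀ s, IsPadding (z.map Prod.snd) s → (s ∈ tensorLang (OddLang D) ↔
      (∀ o ∈ z.map Prod.snd, o ≠ some fun _ => none) ∧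
      ∀ i, z.map (fun c => (c.1.1, c.2.bind fun f => f i)) ∈ paddedAcceptance σ w) := by
    intro s hs
    rw [hs.mem_tensorLang_iff]
    refine and_congr_right fun _ => forall_congr' fun i => ?_
    rw [mem_paddedAcceptance_iff (D := D) (by simpa [Function.comp_def] using hD) hodd]
    simp [componentPadding, Function.comp_def]
  have hacc : z.map (fun c => (c.1.2, c.2)) ∈ paddedAcceptance (Fin a → Option σ) w ↔
      ∃ s ∈ OddLang D', IsPadding (z.map Prod.snd) s := by
    rw [mem_paddedAcceptance_iff (D := D') (by simpa [Function.comp_def] using hD') hodd']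
    simp [Function.comp_def]
  constructor
  · rintro ⟨h₁, h₂⟩
    obtain ⟨s, hs, hpad⟩ := hacc.1 h₁
    exact ⟨s, ⟨hs, fun hc => h₂ ((key s hpad).1 hc)⟩, hpad⟩
  · rintro ⟨s, ⟨hs, hns⟩, hpad⟩
    exact ⟨hacc.2 ⟨s, hs, hpad⟩, fun hc => hns ((key s hpad).2 hc)⟩

/-- The binary relation `{(D,D') : D ∈ B⊕(Σ,w), D' ∈ B⊕(Σ^{⊗a},w),
L(D') ⊆ L(D)^{⊗a}}` is regular. -/
theorem stmt15 (σ : Type) [Fintype σ] [Nonempty σ] (w a : ℕ) (hw : 0 < w) (ha : 0 < a) :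
    Regular2 { p : List (Layer σ w) × List (Layer (Fin a → Option σ) w) |
      IsODD p.1 ∧ IsODD p.2 ∧ OddLang p.2 ⊆ tensorLang (OddLang p.1) } := by
  unfold Regular2
  convert ((langRegular_forall_mem fun o : Option (Layer σ w) ×
      Option (Layer (Fin a → Option σ) w) => o ≠ (none, none)).inter
    (((langRegular_isODD (σ := σ) (w := w)).comap Prod.fst).inter
      ((langRegular_isODD (σ := Fin a → Option σ) (w := w)).comap Prod.snd))).inter
    (langRegular_nonInclusionWitnesses (σ := σ) (w := w) (a := a)).image_fst.compl using 1
  ext x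
  constructor
  · rintro ⟨⟨D, D'⟩, ⟨hodd, hodd', hsub⟩, hx⟩
    obtain ⟨hD, hD', hnone⟩ := conv2_eq_iff.1 hx
    refine ⟨⟨hnone, ⟨D, hD, hodd⟩, ⟨D', hD', hodd'⟩⟩, ?_⟩
    rintro ⟨z, hz, rfl⟩
    obtain ⟨s, ⟨hs, hns⟩, -⟩ := (mem_nonInclusionWitnesses_iff hD hodd hD' hodd').1 hz
    exact hns (hsub hs)
  · rintro ⟨⟨hnone, ⟨D, hD, hodd⟩, ⟨D', hD', hodd'⟩⟩, hwit⟩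
    refine ⟨(D, D'), ⟨hodd, hodd', fun s hs => ?_⟩, conv2_eq_iff.2 ⟨hD, hD', hnone⟩⟩
    by_contra hns
    have hfst : (x.mapIdx fun i c => (c, s[i]?)).map Prod.fst = x :=
      List.ext_getElem (by simp) fun i _ _ => by simp
    refine hwit ⟨x.mapIdx fun i c => (c, s[i]?), ?_, hfst⟩
    rw [mem_nonInclusionWitnesses_iff (D := D) (D' := D') (by rwa [hfst]) hodd
      (by rwa [hfst]) hodd']
    refine ⟨s, ⟨hs, hns⟩, ?_, fun i hi => by simp⟩
    have := hs.2.1.trans hD'.1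
    simpa using this
end

section
/- Let Σ be an alphabet, w ∈ ℕ⁺, τ = (R₁,…,Rᵣ) a relational vocabulary with arities a₁,…,aᵣ, and φ(x₁,…,x_p) a first-order formula over τ with free variables among x₁,…,x_p. Then the (r+1+p)-ary relation D(Σ,w,τ,φ(x₁,…,x_p)) = {(D₀, D₁, …, Dᵣ, v₁, …, v_p) : (D₀,…,Dᵣ) ∈ D(Σ,w,τ), v₁,…,v_p ∈ L(D₀), and S(D₀,…,Dᵣ) ⊨ φ[v₁,…,v_p]} is regular. -/
open FirstOrder

/-- A predicate on words is recognizable if it is decided by a finite automaton. -/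
def Recognizable {Γ : Type} (P : List Γ → Prop) : Prop :=
  ∃ (S : Type) (_ : Finite S) (M : DFA Γ S), ∀ x, M.eval x ∈ M.accept ↔ P x

namespace Recognizable

variable {Γ Δ : Type}

theorem congr {P Q : List Γ → Prop} (h : Recognizable P) (e : ∀ x, P x ↔ Q x) :
    Recognizable Q := by
  obtain ⟨S, hS, M, hM⟩ := h
  exact ⟨S, hS, M, fun x => (hM x).trans (e x)⟩

theorem langRegular {P : List Γ → Prop} (h : Recognizable P) : LangRegular { x | P x } := by
  obtain ⟨S, hS, M, hM⟩ := h
  refine ⟨S, Fintype.ofFinite S, M, ?_⟩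
  ext x
  exact hM x

theorem not {P : List Γ → Prop} (h : Recognizable P) : Recognizable fun x => ¬ P x := by
  obtain ⟨S, hS, M, hM⟩ := h
  refine ⟨S, hS, ⟨M.step, M.start, M.acceptᶜ⟩, fun x => not_congr (hM x)⟩

theorem and {P Q : List Γ → Prop} (hP : Recognizable P) (hQ : Recognizable Q) :
    Recognizable fun x => P x ∧ Q x := by
  obtain ⟨S, hS, M, hM⟩ := hP
  obtain ⟨T, hT, N, hN⟩ := hQ
  refine ⟨S × T, inferInstance, M.inter N, fun x => ?_⟩
  have : (M.inter N).eval x = (M.eval x, N.eval x) := by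
    induction x using List.reverseRecOn with
    | nil => rfl
    | append_singleton x a ih => simp [ih]
  rw [this]
  exact and_congr (hM x) (hN x)

theorem const (c : Prop) : Recognizable fun _ : List Γ => c :=
  ⟨Unit, inferInstance, ⟨fun _ _ => (), (), { _s | c }⟩, fun _ => Iff.rfl⟩

theorem imp {P Q : List Γ → Prop} (hP : Recognizable P) (hQ : Recognizable Q) :
    Recognizable fun x => P x → Q x :=
  (hP.and hQ.not).not.congr fun x => by tauto

theorem forall_fin {n : ℕ} {P : Fin n → List Γ → Prop} (h : ∀ i, Recognizable (P i)) :
    Recognizable fun x => ∀ i, P i x := by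
  induction n with
  | zero => exact (const True).congr fun x => by simp
  | succ n ih => exact ((h 0).and (ih fun i => h i.succ)).congr fun x =>
      (Fin.forall_fin_succ (P := fun i => P i x)).symm

theorem map {P : List Δ → Prop} (h : Recognizable P) (f : Γ → Δ) :
    Recognizable fun x => P (x.map f) := by
  obtain ⟨S, hS, M, hM⟩ := h
  refine ⟨S, hS, M.comap f, fun x => ?_⟩
  rw [DFA.eval_comap]
  exact hM _

theorem exists_map_eq {P : List Δ → Prop} (h : Recognizable P) (f : Δ → Γ) :
    Recognizable fun x => ∃ y, y.map f = x ∧ P y := by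
  obtain ⟨S, hS, M, hM⟩ := h
  refine ⟨Set S, inferInstance, NFA.toDFA ⟨fun s a => { t | ∃ b, f b = a ∧ M.step s b = t },
    {M.start}, M.accept⟩, fun x => ?_⟩
  set N : NFA Γ S := ⟨fun s a => { t | ∃ b, f b = a ∧ M.step s b = t }, {M.start}, M.accept⟩
  have key : ∀ t, t ∈ N.eval x ↔ ∃ y, y.map f = x ∧ M.eval y = t := by
    induction x using List.reverseRecOn with
    | nil => intro t; simp [N, eq_comm]
    | append_singleton x a ih =>
      intro t
      rw [NFA.eval_append_singleton, NFA.mem_stepSet]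
      constructor
      · rintro ⟨s, hs, b, rfl, rfl⟩
        obtain ⟨y, rfl, rfl⟩ := (ih s).1 hs
        exact ⟨y ++ [b], by simp, by simp⟩
      · rintro ⟨y, hy, rfl⟩
        obtain ⟨y', z, rfl, hy', hz⟩ := List.map_eq_append_iff.1 hy
        obtain ⟨b, rfl, rfl⟩ : ∃ b, z = [b] ∧ f b = a := by
          simpa [List.map_eq_singleton_iff] using hz
        exact ⟨_, (ih _).2 ⟨y', hy', rfl⟩, b, rfl, by simp⟩
  have : N.toDFA.eval x ∈ N.toDFA.accept ↔ ∃ s ∈ N.accept, s ∈ N.eval x := by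
    rw [← DFA.mem_accepts, NFA.toDFA_correct]
    rfl
  rw [this]
  constructor
  · rintro ⟨s, hs, hx⟩
    obtain ⟨y, hy, rfl⟩ := (key s).1 hx
    exact ⟨y, hy, (hM y).1 hs⟩
  · rintro ⟨y, hy, hP⟩
    exact ⟨_, (hM y).2 hP, (key _).2 ⟨y, hy, rfl⟩⟩

theorem head? [Finite Γ] (p : Option Γ → Prop) : Recognizable fun x => p x.head? := by
  refine ⟨Option Γ, inferInstance, ⟨fun s a => s.or (some a), none, { s | p s }⟩, fun x => ?_⟩
  set M : DFA Γ (Option Γ) := ⟨fun s a => s.or (some a), none, { s | p s }⟩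
  suffices h : M.eval x = x.head? by
    rw [h]; rfl
  induction x using List.reverseRecOn with
  | nil => rfl
  | append_singleton x a ih =>
    rw [DFA.eval_append_singleton, ih, List.head?_append]
    rfl

theorem getLast? [Finite Γ] (p : Option Γ → Prop) : Recognizable fun x => p x.getLast? := by
  refine ⟨Option Γ, inferInstance, ⟨fun _ a => some a, none, { s | p s }⟩, fun x => ?_⟩
  suffices h : DFA.eval ⟨fun _ a => some a, none, { s | p s }⟩ x = x.getLast? by
    rw [h]; rfl
  induction x using List.reverseRecOn with
  | nil => rfl
  | append_singleton x a ih => simp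

theorem forall_mem (p : Γ → Prop) : Recognizable fun x => ∀ a ∈ x, p a := by
  refine ⟨Prop, inferInstance, ⟨fun s a => s ∧ p a, True, { s | s }⟩, fun x => ?_⟩
  suffices h : DFA.eval ⟨fun s a => s ∧ p a, True, { s | s }⟩ x ↔ ∀ a ∈ x, p a from h
  induction x using List.reverseRecOn with
  | nil => simp
  | append_singleton x a ih => simp [ih, or_imp, forall_and]

theorem isChain [Finite Γ] (r : Γ → Γ → Prop) : Recognizable fun x => x.IsChain r := by
  refine ⟨Prop × Option Γ, inferInstance,
    ⟨fun s a => (s.1 ∧ ∀ b ∈ s.2, r b a, some a), (True, none), { s | s.1 }⟩, fun x => ?_⟩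
  set M : DFA Γ (Prop × Option Γ) :=
    ⟨fun s a => (s.1 ∧ ∀ b ∈ s.2, r b a, some a), (True, none), { s | s.1 }⟩
  suffices h : M.eval x = (x.IsChain r, x.getLast?) by
    change (M.eval x).1 ↔ _
    rw [h]
  induction x using List.reverseRecOn with
  | nil => simp [M]
  | append_singleton x a ih =>
    rw [DFA.eval_append_singleton, ih]
    simp [M, List.isChain_append]

end Recognizable

section Tracks

variable {α Γ : Type} {w : ℕ}

/-- The track of length `n` holding the string `s` followed by padding symbols. -/
def padTrack (n : ℕ) (s : List α) : List (Option α) :=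
  (List.range n).map fun j => s[j]?

@[simp]
theorem length_padTrack (n : ℕ) (s : List α) : (padTrack n s).length = n := by
  simp [padTrack]

@[simp]
theorem getElem_padTrack (n : ℕ) (s : List α) (j : ℕ) (h : j < (padTrack n s).length) :
    (padTrack n s)[j] = s[j]? := by
  simp [padTrack]

theorem padTrack_injOn {n : ℕ} {s t : List α} (hs : s.length ≤ n) (ht : t.length ≤ n)
    (h : padTrack n s = padTrack n t) : s = t := by
  refine List.ext_getElem? fun j => ?_
  by_cases hj : j < n
  · have := congrArg (fun l => l[j]?) h
    simpa [padTrack, hj] using this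
  · rw [List.getElem?_eq_none (by omega), List.getElem?_eq_none (by omega)]

theorem map_eq_padTrack_iff {g : Γ → Option α} {x : List Γ} {s : List α} :
    x.map g = padTrack x.length s ↔ ∀ j, (h : j < x.length) → g x[j] = s[j]? := by
  constructor
  · intro h j hj
    have := congrArg (fun l => l[j]?) h
    simpa [padTrack, hj] using this
  · intro h
    refine List.ext_getElem (by simp) fun j h₁ h₂ => ?_
    simpa using h j (by simpa using h₁)

theorem exists_eq_padTrack {tr : List (Option α)}
    (h : tr.IsChain fun a b => a = none → b = none) :
    ∃ s : List α, s.length ≤ tr.length ∧ tr = padTrack tr.length s := by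
  induction tr with
  | nil => exact ⟨[], by simp, by simp [padTrack]⟩
  | cons a tr ih =>
    obtain ⟨s, hs, e⟩ := ih h.of_cons
    cases a with
    | some a =>
      refine ⟨a :: s, by simpa using hs, ?_⟩
      rw [List.length_cons, padTrack, List.range_succ_eq_map]
      simpa [padTrack, Function.comp_def] using e
    | none =>
      refine ⟨[], by simp, ?_⟩
      have : ∀ (l : List (Option α)), (none :: l).IsChain (fun a b => a = none → b = none) →
          ∀ b ∈ l, b = none := by
        intro l
        induction l with
        | nil => simp
        | cons c l ih =>
          intro hl
          rw [List.isChain_cons_cons] at hl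
          obtain rfl := hl.1 rfl
          simpa using ih hl.2
      have h0 := this tr h
      rw [List.eq_replicate_of_mem h0]
      simp [padTrack, List.replicate_succ]

/-- The track `tr` holds a string accepted by the ODD `D`, padded to the length of `D`. -/
def IsAcceptedTrack (D : List (Layer α w)) (tr : List (Option α)) : Prop :=
  ∃ s ∈ OddLang D, tr = padTrack D.length s

theorem isAcceptedTrack_padTrack {D : List (Layer α w)} {s : List α} {n : ℕ} (hn : D.length = n)
    (hs : s.length ≤ n) : IsAcceptedTrack D (padTrack n s) ↔ s ∈ OddLang D := by
  subst hn
  constructor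
  · rintro ⟨t, ht, e⟩
    rwa [padTrack_injOn hs ht.2.1 e]
  · exact fun h => ⟨s, h, rfl⟩

theorem isAcceptedTrack_map_iff (D : Γ → Layer α w) (g : Γ → Option α) (x : List Γ) :
    IsAcceptedTrack (x.map D) (x.map g) ↔
      ∃ y : List (Γ × Fin w × Fin w), y.map Prod.fst = x ∧
        (∃ c ∈ y.head?, c.2.1 ∈ (D c.1).initial ∧ g c.1 ≠ none) ∧
        (∃ c ∈ y.getLast?, c.2.2 ∈ (D c.1).final) ∧
        (∀ c ∈ y, (c.2.1, g c.1, c.2.2) ∈ (D c.1).trans) ∧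
        y.IsChain fun c d => c.2.2 = d.2.1 ∧ (g c.1 = none → g d.1 = none) := by
  constructor
  · rintro ⟨s, ⟨hs0, hs, st, htr, hends⟩, e⟩
    rw [List.length_map, map_eq_padTrack_iff] at e
    rw [List.length_map] at hs
    simp only [List.length_map, List.getElem_map] at htr hends
    have hs0' : 0 < s.length := List.length_pos_iff.2 hs0
    have hx : 0 < x.length := by omega
    obtain ⟨h1, h2⟩ := hends hx
    refine ⟨List.ofFn fun i : Fin x.length => (x[i], st i, st (i + 1)), ?_, ?_, ?_, ?_, ?_⟩
    · refine List.ext_getElem (by simp) fun j _ _ => ?_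
      simp
    · refine ⟨(x[0], st 0, st 1), ?_, h1, ?_⟩
      · simp [List.head?_eq_getElem?, hx]
      · simp [e 0 hx, hs0]
    · refine ⟨(x[x.length - 1], st (x.length - 1), st (x.length - 1 + 1)), ?_, ?_⟩
      · simp [List.getLast?_eq_getElem?, hx]
      · rwa [Nat.sub_add_cancel hx]
    · intro c hc
      obtain ⟨i, rfl⟩ := (List.mem_ofFn' _ _).1 hc
      have := htr i i.2
      rwa [← e i i.2] at this
    · rw [List.isChain_iff_getElem]
      intro i hi
      simp only [List.length_ofFn] at hi
      simp only [List.getElem_ofFn, Fin.getElem_fin]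
      refine ⟨trivial, ?_⟩
      rw [e _ (by omega), e _ hi]
      simp only [List.getElem?_eq_none_iff]
      omega
  · rintro ⟨y, rfl, ⟨c, hc, hc1, hc2⟩, ⟨d, hd, hd1⟩, htr, hch⟩
    obtain ⟨s, hs, e⟩ := exists_eq_padTrack (tr := (y.map Prod.fst).map g) <| by
      rw [List.isChain_map, List.isChain_map]
      exact hch.imp fun _ _ h => h.2
    rw [List.length_map] at hs e
    have e' := map_eq_padTrack_iff.1 e
    rw [List.head?_eq_getElem?, Option.mem_def, List.getElem?_eq_some_iff] at hc
    rw [List.getLast?_eq_getElem?, Option.mem_def, List.getElem?_eq_some_iff] at hd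
    obtain ⟨hy, rfl⟩ := hc
    obtain ⟨hy', rfl⟩ := hd
    rw [List.isChain_iff_getElem] at hch
    refine ⟨s, ⟨?_, by simpa using hs, fun i => if h : i < y.length then y[i].2.1 else
      y[y.length - 1].2.2, ?_, ?_⟩, by simpa using e⟩
    · rintro rfl
      have := e' 0 (by simpa using hy)
      simp only [List.getElem_map] at this
      exact hc2 (by simpa using this)
    · intro i hi
      simp only [List.length_map] at hi
      have h1 := e' i (by simpa using hi)
      have h2 := htr y[i] (List.getElem_mem hi)
      rw [← h1]
      simp only [List.getElem_map, hi, dite_true]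
      split_ifs with h
      · rw [← (hch i h).1]; exact h2
      · obtain rfl : i = y.length - 1 := by omega
        exact h2
    · intro h
      simp only [List.length_map, List.getElem_map, hy, dite_true, lt_irrefl, dite_false]
      exact ⟨hc1, hd1⟩

theorem recognizable_isAcceptedTrack [Finite Γ] (D : Γ → Layer α w) (g : Γ → Option α) :
    Recognizable fun x : List Γ => IsAcceptedTrack (x.map D) (x.map g) := by
  refine Recognizable.congr (Recognizable.exists_map_eq ?_ Prod.fst)
    fun x => (isAcceptedTrack_map_iff D g x).symm
  exact ((Recognizable.head? (fun o : Option (Γ × Fin w × Fin w) =>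
      ∃ c ∈ o, c.2.1 ∈ (D c.1).initial ∧ g c.1 ≠ none)).and
    ((Recognizable.getLast? (fun o : Option (Γ × Fin w × Fin w) =>
      ∃ c ∈ o, c.2.2 ∈ (D c.1).final)).and
      ((Recognizable.forall_mem _).and (Recognizable.isChain _))))

open Classical in
/-- The letter of a convolution with given components, which is the padding symbol if all
components are. -/
noncomputable def convLetter {a : ℕ} (f : Fin a → Option α) : Option (Fin a → Option α) :=
  if ∀ m, f m = none then none else some f

theorem getElem?_convD_s17 {a : ℕ} (us : Fin a → List α) (j : ℕ) :
    (convD us)[j]? = convLetter fun m => (us m)[j]? := by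
  have h : j < (Finset.univ.sup fun m => (us m).length) ↔ ¬ ∀ m, (us m)[j]? = none := by
    simp [Finset.lt_sup_iff]
  unfold convLetter
  split_ifs with h0
  · rw [List.getElem?_eq_none_iff, convD, List.length_ofFn]
    exact not_lt.1 fun h1 => h.1 h1 h0
  · rw [convD, List.getElem?_ofFn, dif_pos (h.2 h0)]

theorem length_convD_le {a n : ℕ} {us : Fin a → List α} (h : ∀ m, (us m).length ≤ n) :
    (convD us).length ≤ n := by
  rw [convD, List.length_ofFn]
  exact Finset.sup_le fun m _ => h m

theorem map_convLetter {a : ℕ} {g : Fin a → Γ → Option α} {x : List Γ} {us : Fin a → List α}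
    (h : ∀ m, x.map (g m) = padTrack x.length (us m)) :
    x.map (fun c => convLetter fun m => g m c) = padTrack x.length (convD us) := by
  rw [map_eq_padTrack_iff]
  intro j hj
  rw [getElem?_convD_s17]
  congr 1
  funext m
  exact map_eq_padTrack_iff.1 (h m) j hj

theorem recognizable_isODD [Finite Γ] (D : Γ → Layer α w) :
    Recognizable fun x : List Γ => IsODD (x.map D) := by
  have h := (Recognizable.head? (fun o : Option Γ => ∃ c ∈ o, (D c).ini = true)).and
    ((Recognizable.getLast? (fun o : Option Γ => ∃ c ∈ o, (D c).fin = true)).and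
      (Recognizable.isChain fun c d : Γ =>
        (D d).left = (D c).right ∧ (D d).ini = false ∧ (D c).fin = false))
  refine h.congr fun x => ?_
  simp only [List.head?_eq_getElem?, List.getLast?_eq_getElem?, Option.mem_def,
    List.getElem?_eq_some_iff, List.isChain_iff_getElem, IsODD, List.length_map, List.getElem_map,
    ne_eq, List.map_eq_nil_iff]
  constructor
  · rintro ⟨⟨_, ⟨h0, rfl⟩, h1⟩, ⟨_, ⟨_, rfl⟩, h2⟩, h3⟩
    refine ⟨List.length_pos_iff.1 h0, fun i h => (h3 i h).1, fun i h => ⟨?_, ?_⟩⟩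
    · cases i with
      | zero => simpa using h1
      | succ i => simp [(h3 i h).2.1]
    · by_cases hi : i + 1 < x.length
      · simp only [(h3 i hi).2.2]
        constructor
        · simp
        · omega
      · obtain rfl : i = x.length - 1 := by omega
        simpa using h2
  · rintro ⟨h0, h1, h2⟩
    have h0 : 0 < x.length := List.length_pos_iff.2 h0
    refine ⟨⟨_, ⟨h0, rfl⟩, (h2 0 h0).1.2 rfl⟩,
      ⟨_, ⟨Nat.sub_lt h0 one_pos, rfl⟩, (h2 _ (Nat.sub_lt h0 one_pos)).2.2 rfl⟩, fun i h => ⟨h1 i h, ?_, ?_⟩⟩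
    · rw [Bool.eq_false_iff, ne_eq, (h2 _ h).1]
      omega
    · rw [Bool.eq_false_iff, ne_eq, (h2 _ (Nat.lt_of_succ_lt h)).2]
      omega

end Tracks

instance Layer.instFinite {α : Type} [Finite α] {w : ℕ} : Finite (Layer α w) := by
  refine Finite.of_injective (β := Set (Fin w) × Set (Fin w) × Set (Fin w × Option α × Fin w) ×
    Set (Fin w) × Set (Fin w) × Bool × Bool)
    (fun L => (L.left, L.right, L.trans, L.initial, L.final, L.ini, L.fin)) ?_
  rintro ⟨⟩ ⟨⟩ h
  simpa using h

theorem exists_map_fst_map_snd {α β : Type} {x : List α} {l : List β} (h : l.length = x.length) :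
    ∃ z : List (α × β), z.map Prod.fst = x ∧ z.map Prod.snd = l :=
  ⟨x.zip l, List.map_fst_zip h.ge, List.map_snd_zip h.le⟩

section Structural

variable {σ Γ : Type} {w : ℕ}

theorem recognizable_tensorLang [Finite σ] [Finite Γ] {a : ℕ} (D : Γ → Layer σ w)
    (g : Γ → Option (Fin a → Option σ)) :
    Recognizable fun x : List Γ =>
      ∃ s ∈ tensorLang (OddLang (x.map D)), x.map g = padTrack x.length s := by
  refine Recognizable.congr (Recognizable.exists_map_eq
    (P := fun y : List (Γ × (Fin a → Option σ)) =>
      (∀ m, IsAcceptedTrack (y.map fun c => D c.1) (y.map fun c => c.2 m)) ∧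
        ∀ c ∈ y, g c.1 = convLetter c.2) ?_ Prod.fst) fun x => ?_
  · exact (Recognizable.forall_fin fun m => recognizable_isAcceptedTrack _ _).and
      (Recognizable.forall_mem _)
  · constructor
    · rintro ⟨y, rfl, hacc, hconv⟩
      choose us hus htr using hacc
      refine ⟨convD us, ⟨us, fun m => ?_, rfl⟩, ?_⟩
      · rw [List.map_map]; exact hus m
      · rw [List.map_map, List.length_map, ← map_convLetter (g := fun m (c : Γ × (Fin a → Option σ)) => c.2 m)
          (fun m => by simpa using htr m)]
        exact List.map_inj_left.2 hconv
    · rintro ⟨_, ⟨us, hus, rfl⟩, htr⟩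
      obtain ⟨y, rfl, hy⟩ := exists_map_fst_map_snd (x := x)
        (l := (List.range x.length).map fun j m => (us m)[j]?) (by simp)
      rw [List.length_map] at hy htr
      have hm : ∀ m, y.map (fun c => c.2 m) = padTrack y.length (us m) := fun m => by
        have := congrArg (List.map fun f : Fin a → Option σ => f m) hy
        simpa [padTrack, Function.comp_def] using this
      refine ⟨y, rfl, fun m => ⟨us m, ?_, ?_⟩, List.map_inj_left.1 ?_⟩
      · have := hus m
        rwa [List.map_map] at this
      · rw [hm, List.length_map]
      · rw [map_convLetter hm, ← htr, List.map_map]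
        rfl

theorem recognizable_subset_tensorLang [Finite σ] [Finite Γ] {a : ℕ} (D : Γ → Layer σ w)
    (E : Γ → Layer (Fin a → Option σ) w) :
    Recognizable fun x : List Γ => OddLang (x.map E) ⊆ tensorLang (OddLang (x.map D)) := by
  refine Recognizable.congr (Recognizable.exists_map_eq
    (P := fun z : List (Γ × Option (Fin a → Option σ)) =>
      IsAcceptedTrack (z.map fun c => E c.1) (z.map Prod.snd) ∧
        ¬ ∃ s ∈ tensorLang (OddLang (z.map fun c => D c.1)),
          z.map Prod.snd = padTrack z.length s) ?_ Prod.fst).not fun x => ?_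
  · exact (recognizable_isAcceptedTrack _ _).and (recognizable_tensorLang _ _).not
  · constructor
    · intro h s hs
      by_contra hns
      obtain ⟨z, rfl, hz⟩ := exists_map_fst_map_snd (x := x) (l := padTrack x.length s) (by simp)
      rw [List.map_map] at hs hns
      rw [List.length_map] at hz
      refine h ⟨z, rfl, ⟨s, hs, by rw [hz, List.length_map]⟩, ?_⟩
      rintro ⟨t, ht, e⟩
      rw [hz] at e
      have htl : t.length ≤ z.length := by
        obtain ⟨us, hus, rfl⟩ := ht
        refine length_convD_le fun m => ?_
        have := (hus m).2.1
        rwa [List.length_map] at this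
      have hsl := hs.2.1
      rw [List.length_map] at hsl
      obtain rfl := padTrack_injOn hsl htl e
      exact hns ht
    · rintro h ⟨z, rfl, ⟨s, hs, e⟩, hns⟩
      rw [List.map_map, List.map_map] at h
      rw [List.length_map] at e
      exact hns ⟨s, h hs, e⟩

theorem recognizable_isStructural [Finite σ] [Finite Γ] {r : ℕ} {ar : Fin r → ℕ}
    (D₀ : Γ → Layer σ w) (Ds : ∀ i : Fin r, Γ → Layer (Fin (ar i) → Option σ) w) :
    Recognizable fun x : List Γ => IsStructural (x.map D₀) fun i => x.map (Ds i) := by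
  refine ((recognizable_isODD D₀).and (Recognizable.forall_fin fun i =>
    (recognizable_isODD (Ds i)).and (recognizable_subset_tensorLang D₀ (Ds i)))).congr fun x => ?_
  simp [IsStructural]

end Structural

section Realize

open FirstOrder.Language

variable {σ : Type} {w r : ℕ} {ar : Fin r → ℕ} {p : ℕ}

/-- The tracks hold, padded, elements of the domain of the derived structure satisfying the
formula. -/
def SatisfiedByTracks {n : ℕ} (φ : (vocLang r ar).BoundedFormula (Fin p) n)
    (D₀ : List (Layer σ w)) (Ds : ∀ i : Fin r, List (Layer (Fin (ar i) → Option σ) w))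
    (tr : Fin p ⊕ Fin n → List (Option σ)) : Prop :=
  ∃ u : Fin p ⊕ Fin n → { s : List σ // s ∈ OddLang D₀ },
    (∀ t, tr t = padTrack D₀.length (u t).1) ∧
      letI := derivedStr D₀ Ds
      φ.Realize (u ∘ Sum.inl) (u ∘ Sum.inr)

theorem satisfiedByTracks_iff {n : ℕ} {φ : (vocLang r ar).BoundedFormula (Fin p) n}
    {D₀ : List (Layer σ w)} {Ds : ∀ i : Fin r, List (Layer (Fin (ar i) → Option σ) w)}
    {tr : Fin p ⊕ Fin n → List (Option σ)} {u : Fin p ⊕ Fin n → { s : List σ // s ∈ OddLang D₀ }}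
    (hu : ∀ t, tr t = padTrack D₀.length (u t).1) :
    SatisfiedByTracks φ D₀ Ds tr ↔
      letI := derivedStr D₀ Ds
      φ.Realize (u ∘ Sum.inl) (u ∘ Sum.inr) := by
  constructor
  · rintro ⟨u', hu', h⟩
    obtain rfl : u' = u := funext fun t => Subtype.ext
      (padTrack_injOn (u' t).2.2.1 (u t).2.2.1 ((hu' t).symm.trans (hu t)))
    exact h
  · exact fun h => ⟨u, hu, h⟩

theorem Recognizable.satisfiedByTracks {Γ : Type} [Finite Γ] {n : ℕ}
    {φ : (vocLang r ar).BoundedFormula (Fin p) n}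
    {D₀ : Γ → Layer σ w} {Ds : ∀ i : Fin r, Γ → Layer (Fin (ar i) → Option σ) w}
    {G : Fin p ⊕ Fin n → Γ → Option σ} {R : List Γ → Prop} (hR : Recognizable R)
    (h : ∀ (x : List Γ) (u : Fin p ⊕ Fin n → { s : List σ // s ∈ OddLang (x.map D₀) }),
      (∀ t, x.map (G t) = padTrack x.length (u t).1) →
        (R x ↔ letI := derivedStr (x.map D₀) (fun i => x.map (Ds i))
          φ.Realize (u ∘ Sum.inl) (u ∘ Sum.inr))) :
    Recognizable fun x => SatisfiedByTracks φ (x.map D₀) (fun i => x.map (Ds i))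
      fun t => x.map (G t) := by
  refine (((Recognizable.forall_fin fun t => recognizable_isAcceptedTrack D₀ (G (.inl t))).and
    (Recognizable.forall_fin fun t => recognizable_isAcceptedTrack D₀ (G (.inr t)))).and
      hR).congr fun x => ?_
  constructor
  · rintro ⟨⟨h₁, h₂⟩, hx⟩
    have h₃ : ∀ t, IsAcceptedTrack (x.map D₀) (x.map (G t)) := Sum.forall.2 ⟨h₁, h₂⟩
    choose s hs e using h₃
    exact ⟨fun t => ⟨s t, hs t⟩, e, (h x _ fun t => by simpa using e t).1 hx⟩
  · rintro ⟨u, hu, hr⟩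
    exact ⟨⟨fun t => ⟨_, (u (.inl t)).2, hu _⟩, fun t => ⟨_, (u (.inr t)).2, hu _⟩⟩,
      (h x u fun t => by simpa using hu t).2 hr⟩

theorem exists_eq_var {β : Type} (t : (vocLang r ar).Term β) : ∃ b, t = .var b := by
  cases t with
  | var b => exact ⟨b, rfl⟩
  | func f _ => exact f.elim

theorem recognizable_satisfiedByTracks [Finite σ] {n : ℕ}
    (φ : (vocLang r ar).BoundedFormula (Fin p) n) :
    ∀ {Γ : Type} [Finite Γ] (D₀ : Γ → Layer σ w)
      (Ds : ∀ i : Fin r, Γ → Layer (Fin (ar i) → Option σ) w)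
      (G : Fin p ⊕ Fin n → Γ → Option σ),
      Recognizable fun x => SatisfiedByTracks φ (x.map D₀) (fun i => x.map (Ds i))
        fun t => x.map (G t) := by
  induction φ with
  | falsum =>
    intro Γ _ D₀ Ds G
    exact (Recognizable.const False).satisfiedByTracks fun x u hu => Iff.rfl
  | equal t₁ t₂ =>
    intro Γ _ D₀ Ds G
    obtain ⟨a, rfl⟩ := exists_eq_var t₁
    obtain ⟨b, rfl⟩ := exists_eq_var t₂
    refine (Recognizable.forall_mem fun c => G a c = G b c).satisfiedByTracks fun x u hu => ?_
    rw [← List.map_inj_left, hu, hu]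
    simp only [BoundedFormula.Realize, Term.realize_var, Sum.elim_comp_inl_inr]
    constructor
    · intro h
      exact Subtype.ext (padTrack_injOn (by simpa using (u a).2.2.1)
        (by simpa using (u b).2.2.1) h)
    · intro h
      rw [h]
  | rel R ts =>
    intro Γ _ D₀ Ds G
    obtain ⟨i, rfl⟩ := R
    choose b hb using fun m => exists_eq_var (ts m)
    obtain rfl : ts = fun m => .var (b m) := funext hb
    refine (recognizable_isAcceptedTrack (Ds i)
      (fun c => convLetter fun m => G (b m) c)).satisfiedByTracks fun x u hu => ?_
    rw [map_convLetter (fun m => hu (b m)), isAcceptedTrack_padTrack (List.length_map _)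
      (length_convD_le fun m => by simpa using (u (b m)).2.2.1)]
    simp only [BoundedFormula.Realize, Term.realize_var, Sum.elim_comp_inl_inr]
    rfl
  | imp φ ψ ihφ ihψ =>
    intro Γ _ D₀ Ds G
    refine ((ihφ D₀ Ds G).imp (ihψ D₀ Ds G)).satisfiedByTracks fun x u hu => ?_
    have hu' : ∀ t, x.map (G t) = padTrack (x.map D₀).length (u t).1 := by simpa using hu
    rw [satisfiedByTracks_iff hu', satisfiedByTracks_iff hu']
    rfl
  | @all n φ ih =>
    intro Γ _ D₀ Ds G
    let G' : Fin p ⊕ Fin (n + 1) → Γ × Option σ → Option σ :=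
      Sum.elim (fun t c => G (.inl t) c.1)
        (Fin.snoc (α := fun _ => Γ × Option σ → Option σ) (fun t c => G (.inr t) c.1) Prod.snd)
    have hrec : Recognizable fun x : List Γ => ∃ z : List (Γ × Option σ), z.map Prod.fst = x ∧
        IsAcceptedTrack (z.map fun c => D₀ c.1) (z.map Prod.snd) ∧
          ¬ SatisfiedByTracks φ (z.map fun c => D₀ c.1) (fun i => z.map fun c => Ds i c.1)
            fun t => z.map (G' t) :=
      ((recognizable_isAcceptedTrack _ _).and
        (ih (fun c => D₀ c.1) (fun i c => Ds i c.1) G').not).exists_map_eq Prod.fst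
    refine hrec.not.satisfiedByTracks fun x u hu => ?_
    have key : ∀ (z : List (Γ × Option σ)) (a : { s : List σ // s ∈ OddLang (x.map D₀) }),
        z.map Prod.fst = x → z.map Prod.snd = padTrack x.length a.1 →
        ((SatisfiedByTracks φ (z.map fun c => D₀ c.1) (fun i => z.map fun c => Ds i c.1)
            fun t => z.map (G' t)) ↔
          letI := derivedStr (x.map D₀) (fun i => x.map (Ds i))
          φ.Realize (u ∘ Sum.inl) (Fin.snoc (u ∘ Sum.inr) a)) := by
      rintro z a rfl hz
      have e₀ : (z.map fun c => D₀ c.1) = (z.map Prod.fst).map D₀ := by simp [Function.comp_def]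
      have e₁ : (fun i => z.map fun c => Ds i c.1) = fun i => (z.map Prod.fst).map (Ds i) := by
        simp [Function.comp_def]
      rw [e₀, e₁, satisfiedByTracks_iff (u := Sum.elim (u ∘ Sum.inl) (Fin.snoc (u ∘ Sum.inr) a))]
      · rw [Sum.elim_comp_inl, Sum.elim_comp_inr]
      · rintro (t | t)
        · simpa [G', Function.comp_def] using hu (.inl t)
        · refine Fin.lastCases ?_ (fun t => ?_) t
          · simpa [G'] using hz
          · simpa [G', Function.comp_def] using hu (.inr t)
    change _ ↔ ∀ a, @BoundedFormula.Realize _ _ (derivedStr (x.map D₀) fun i => x.map (Ds i)) _ _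
      φ (u ∘ Sum.inl) (Fin.snoc (u ∘ Sum.inr) a)
    constructor
    · intro h a
      by_contra hna
      obtain ⟨z, hzx, hz⟩ := exists_map_fst_map_snd (x := x) (l := padTrack x.length a.1) (by simp)
      refine h ⟨z, hzx, ?_, fun hs => hna ((key z a hzx hz).1 hs)⟩
      subst hzx
      refine ⟨a.1, by simpa [Function.comp_def] using a.2, by simpa using hz⟩
    · rintro h ⟨z, hzx, ⟨s, hs, e⟩, hns⟩
      have hs' : s ∈ OddLang (x.map D₀) := by
        subst hzx
        simpa [Function.comp_def] using hs
      refine hns ((key z ⟨s, hs'⟩ hzx ?_).2 (h _))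
      subst hzx
      simpa using e

end Realize

theorem convStruct_eq_map {σ : Type} {w r : ℕ} {ar : Fin r → ℕ} {p : ℕ}
    {q : StructTupleV σ w r ar p}
    {y : List ((Layer σ w × ((i : Fin r) → Layer (Fin (ar i) → Option σ) w)) ×
      (Fin p → Option σ))}
    (h₀ : y.map (fun c => c.1.1) = q.1.1) (h₁ : ∀ i, y.map (fun c => c.1.2 i) = q.1.2 i)
    (h₂ : ∀ t, y.map (fun c => c.2 t) = padTrack y.length (q.2 t))
    (h₃ : ∀ t, (q.2 t).length ≤ y.length) :
    convStruct q = y.map fun c => ((some c.1.1, fun i => some (c.1.2 i)), c.2) := by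
  refine List.ext_getElem ?_ fun j hj₁ hj₂ => ?_
  · have h₀' : q.1.1.length = y.length := by rw [← h₀, List.length_map]
    have h₁' : ∀ i, (q.1.2 i).length = y.length := fun i => by rw [← h₁, List.length_map]
    rw [convStruct, List.length_ofFn, List.length_map, h₀', max_eq_left, max_eq_left]
    · exact Finset.sup_le fun i _ => (h₁' i).le
    · exact (Finset.sup_le fun t _ => h₃ t).trans (le_max_left _ _)
  · rw [List.length_map] at hj₂
    have h₄ : ∀ t, (q.2 t)[j]? = y[j].2 t := fun t => (map_eq_padTrack_iff.1 (h₂ t) j hj₂).symm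
    simp [convStruct, ← h₀, ← h₁, h₄, hj₂]

/-- For every first-order formula `φ(x₁,…,x_p)` over `τ`, the `(r+1+p)`-ary
relation of structural tuples together with a satisfying interpretation of the
free variables is regular. -/
theorem stmt17 (σ : Type) [Fintype σ] [Nonempty σ] (w : ℕ) (hw : 0 < w)
    (r : ℕ) (ar : Fin r → ℕ) (har : ∀ i, 0 < ar i) (p : ℕ)
    (φ : (vocLang r ar).Formula (Fin p)) :
    RegularStruct { q : StructTupleV σ w r ar p |
      IsStructural q.1.1 q.1.2 ∧
      ∃ h : ∀ t, q.2 t ∈ OddLang q.1.1,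
        letI := derivedStr q.1.1 q.1.2
        φ.Realize (fun t => (⟨q.2 t, h t⟩ : { s : List σ // s ∈ OddLang q.1.1 })) } := by
  let Γ := (Layer σ w × ((i : Fin r) → Layer (Fin (ar i) → Option σ) w)) × (Fin p → Option σ)
  let D₀ : Γ → Layer σ w := fun c => c.1.1
  let Ds : ∀ i : Fin r, Γ → Layer (Fin (ar i) → Option σ) w := fun i c => c.1.2 i
  let G : Fin p ⊕ Fin 0 → Γ → Option σ := Sum.elim (fun t c => c.2 t) Fin.elim0
  refine (((recognizable_isStructural D₀ Ds).and
    (recognizable_satisfiedByTracks φ D₀ Ds G)).exists_map_eq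
      fun c => ((some c.1.1, fun i => some (c.1.2 i)), c.2)).congr (fun x => ?_) |>.langRegular
  constructor
  · rintro ⟨y, rfl, hstr, u, hu, hφ⟩
    rw [List.length_map] at hu
    refine ⟨((y.map D₀, fun i => y.map (Ds i)), fun t => (u (.inl t)).1),
      ⟨hstr, fun t => (u (.inl t)).2, ?_⟩,
      convStruct_eq_map rfl (fun _ => rfl) (fun t => hu (.inl t)) fun t => ?_⟩
    · rw [Subsingleton.elim (u ∘ Sum.inr) default] at hφ
      exact hφ
    · simpa using (u (.inl t)).2.2.1
  · rintro ⟨⟨⟨E₀, Es⟩, v⟩, ⟨hstr, hv, hφ⟩, rfl⟩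
    dsimp only at hstr hv hφ
    have hlen : ∀ i, (Es i).length = E₀.length := fun i => (hstr.2 i).2.1
    obtain ⟨y, hy₀, hy₁, hy₂⟩ : ∃ y : List Γ, y.map D₀ = E₀ ∧ (∀ i, y.map (Ds i) = Es i) ∧
        ∀ t, y.map (fun c => c.2 t) = padTrack y.length (v t) := by
      refine ⟨List.ofFn fun j : Fin E₀.length => ((E₀[j], fun i => (Es i)[(j : ℕ)]'(by
        rw [hlen]; exact j.2)), fun t => (v t)[(j : ℕ)]?), ?_, fun i => ?_, fun t => ?_⟩
      · exact List.ext_getElem (by simp) fun j _ _ => by simp [D₀]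
      · exact List.ext_getElem (by simp [hlen]) fun j _ _ => by simp [Ds]
      · exact map_eq_padTrack_iff.2 fun j hj => by simp
    obtain rfl := hy₀
    obtain rfl : (fun i => y.map (Ds i)) = Es := funext hy₁
    refine ⟨y, (convStruct_eq_map rfl (fun _ => rfl) hy₂ fun t => ?_).symm, hstr,
      Sum.elim (fun t => ⟨v t, hv t⟩) Fin.elim0, ?_, ?_⟩
    · simpa using (hv t).2.1
    · rintro (t | t)
      · rw [List.length_map]
        exact hy₂ t
      · exact t.elim0
    · rw [Sum.elim_comp_inl, Sum.elim_comp_inr, Subsingleton.elim (Fin.elim0) default]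
      exact hφ
end
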